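/- arXiv:2404.06293 — 2 statements merged into one kernel-verified Lean document; each statement's English description precedes it below -/
import Mathlib

section
/- Let A be a finite set with |A| = n, let best be a function assigning to each nonempty subset S ⊆ A an element best(S) ∈ S, and fix an integer k with 1 ≤ k < n. Let a_1, …, a_n be a uniformly random ordering of A (uniform over all n! orderings), and let T be the least t ∈ {k+1, …, n} such that a_t = best({a_1, …, a_t}), with T = ∞ if no such t exists. Then for every t with k < t ≤ n and every subset S ⊆ A with |S| = t, Pr[T = t | {a_1, …, a_t} = S] = k/(t(t−1)); in particular the event {T = t} is independent of the set of agents arriving in the first t steps. -/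
open Finset

attribute [local instance] Classical.propDecidable


/-- `π` agrees with `σ` from time `t` on. -/
def SAgree {α : Type*} {n : ℕ} (t : ℕ) (σ π : Fin n ≃ α) : Prop :=
  ∀ i : Fin n, t ≤ (i : ℕ) → π i = σ i

lemma SAgree.symm' {α : Type*} {n : ℕ} {t : ℕ} {σ π : Fin n ≃ α} (h : SAgree t σ π) :
    SAgree t π σ := fun i hi => (h i hi).symm

lemma SAgree.aux {α : Type*} {n : ℕ} {t : ℕ} {σ π : Fin n ≃ α} (h : SAgree t σ π) (x : α)
    (hx : (π.symm x : ℕ) < t) : (σ.symm x : ℕ) < t := by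
  by_contra hc
  have h1 := h (σ.symm x) (by omega)
  have h2 : π.symm x = σ.symm x := by
    rw [Equiv.symm_apply_eq, h1, Equiv.apply_symm_apply]
  rw [h2] at hx
  exact hc hx

lemma sagree_rec {α : Type*} [Fintype α] [DecidableEq α] {n : ℕ} (t : Fin n)
    (σ : Fin n ≃ α) (Q : (Fin n ≃ α) → Prop) :
    (Finset.univ.filter (fun π : Fin n ≃ α => SAgree ((t : ℕ) + 1) σ π ∧ Q π)).card
      = ∑ j ∈ Finset.Iic t, (Finset.univ.filter
        (fun π : Fin n ≃ α => SAgree (t : ℕ) ((Equiv.swap j t).trans σ) π ∧ Q π)).card := by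
  rw [Finset.card_eq_sum_card_fiberwise (f := fun π : Fin n ≃ α => σ.symm (π t))
    (t := Finset.Iic t)]
  · refine Finset.sum_congr rfl fun j hj => ?_
    rw [Finset.mem_Iic] at hj
    rw [Finset.filter_filter]
    congr 1
    ext π
    simp only [Finset.mem_filter, Finset.mem_univ, true_and]
    constructor
    · rintro ⟨⟨h1, h2⟩, h3⟩
      refine ⟨fun i hi => ?_, h2⟩
      rw [Equiv.symm_apply_eq] at h3
      by_cases hit : i = t
      · subst hit
        simpa using h3
      · have : t < i := lt_of_le_of_ne hi (Ne.symm hit)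
        have hij : i ≠ j := (lt_of_le_of_lt hj this).ne'
        rw [Equiv.trans_apply, Equiv.swap_apply_of_ne_of_ne hij hit]
        exact h1 i this
    · rintro ⟨h1, h2⟩
      refine ⟨⟨fun i hi => ?_, h2⟩, ?_⟩
      · have : t < i := hi
        have hij : i ≠ j := (lt_of_le_of_lt hj this).ne'
        rw [h1 i this.le, Equiv.trans_apply, Equiv.swap_apply_of_ne_of_ne hij this.ne']
      · rw [h1 t le_rfl]
        simp
  · intro π hπ
    simp only [Finset.coe_filter, Finset.mem_univ, true_and, Set.mem_ofPred_eq] at hπ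
    simp only [Finset.coe_Iic, Set.mem_Iic]
    have := hπ.1.aux (π t) (by simp)
    exact Fin.le_def.mpr (by omega)

lemma sagree_card {α : Type*} [Fintype α] [DecidableEq α] {n : ℕ} (t : ℕ) (ht : t ≤ n) :
    ∀ σ : Fin n ≃ α,
    (Finset.univ.filter (fun π : Fin n ≃ α => SAgree t σ π)).card = t.factorial := by
  induction t with
  | zero =>
    intro σ
    rw [Nat.factorial_zero, Finset.card_eq_one]
    refine ⟨σ, ?_⟩
    ext π
    simp only [Finset.mem_filter, Finset.mem_univ, true_and, Finset.mem_singleton]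
    constructor
    · intro h
      ext i
      exact h i (Nat.zero_le _)
    · rintro rfl i _
      rfl
  | succ t ih =>
    intro σ
    have h := sagree_rec (⟨t, ht⟩ : Fin n) σ (fun _ => True)
    simp only [and_true] at h
    rw [h, Finset.sum_congr rfl (fun j _ => ih (by omega) _)]
    simp [Nat.factorial_succ]

/-- Stopped-at-`t+1` and not-stopped counts inside one suffix class. -/
lemma sagree_nostop {α : Type*} [Fintype α] [DecidableEq α] {n : ℕ} (k : ℕ) (hk : 1 ≤ k)
    (stops : (Fin n ≃ α) → ℕ → Prop)
    (b : (Fin n ≃ α) → ℕ → α)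
    (hb : ∀ σ π t, SAgree t σ π → b π t = b σ t)
    (hlt : ∀ (π : Fin n ≃ α) (t : ℕ), 1 ≤ t → t ≤ n → (π.symm (b π t) : ℕ) < t)
    (hs : ∀ (π : Fin n ≃ α) (t : ℕ), stops π t ↔ (π.symm (b π t) : ℕ) = t - 1)
    (t : ℕ) (hkt : k ≤ t) : t ≤ n →
    ∀ σ : Fin n ≃ α,
    (Finset.univ.filter (fun π : Fin n ≃ α => SAgree t σ π ∧
      ∀ s, k < s → s ≤ t → ¬ stops π s)).card = k * (t - 1).factorial := by
  induction t, hkt using Nat.le_induction with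
  | base =>
    intro ht σ
    have : ∀ π : Fin n ≃ α, (SAgree k σ π ∧ ∀ s, k < s → s ≤ k → ¬ stops π s) ↔ SAgree k σ π :=
      fun π => ⟨fun h => h.1, fun h => ⟨h, fun s h1 h2 => by omega⟩⟩
    simp only [this]
    rw [sagree_card k ht, Nat.mul_factorial_pred (by omega)]
  | succ t hkt ih =>
    intro ht σ
    rw [sagree_rec (⟨t, ht⟩ : Fin n) σ]
    have hj0 := hlt σ (t + 1) (by omega) ht
    set j0 := σ.symm (b σ (t + 1)) with hj0def
    have key : ∀ j ∈ Finset.Iic (⟨t, ht⟩ : Fin n), (Finset.univ.filter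
        (fun π : Fin n ≃ α => SAgree t ((Equiv.swap j ⟨t, ht⟩).trans σ) π ∧
          ∀ s, k < s → s ≤ t + 1 → ¬ stops π s)).card
        = if j = j0 then 0 else k * (t - 1).factorial := by
      intro j hj
      rw [Finset.mem_Iic] at hj
      have hst : ∀ π : Fin n ≃ α, SAgree t ((Equiv.swap j ⟨t, ht⟩).trans σ) π →
          (stops π (t + 1) ↔ j = j0) := by
        intro π hπ
        have h1 : π ⟨t, ht⟩ = σ j := by
          rw [hπ ⟨t, ht⟩ le_rfl]; simp
        have h2 : SAgree (t + 1) σ π := by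
          intro i hi
          have hne : i ≠ ⟨t, ht⟩ := by rintro rfl; simp at hi
          have hne' : i ≠ j := by
            rintro rfl
            have := Fin.le_def.mp hj
            simp at this; omega
          rw [hπ i (by omega), Equiv.trans_apply, Equiv.swap_apply_of_ne_of_ne hne' hne]
        rw [hs, hb σ π _ h2, hj0def, Equiv.eq_symm_apply, ← h1]
        constructor
        · intro h
          have : π.symm (b σ (t + 1)) = ⟨t, ht⟩ := Fin.ext (by simpa using h)
          rw [← this]; simp
        · intro h
          rw [← h]; simp
      split_ifs with hjj
      · rw [Finset.card_eq_zero, Finset.filter_eq_empty_iff]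
        rintro π - ⟨h1, h2⟩
        exact h2 (t + 1) (by omega) le_rfl ((hst π h1).2 hjj)
      · rw [← ih (by omega) ((Equiv.swap j ⟨t, ht⟩).trans σ)]
        congr 1
        ext π
        simp only [Finset.mem_filter, Finset.mem_univ, true_and]
        constructor
        · rintro ⟨h1, h2⟩
          exact ⟨h1, fun s h3 h4 => h2 s h3 (by omega)⟩
        · rintro ⟨h1, h2⟩
          refine ⟨h1, fun s h3 h4 => ?_⟩
          rcases Nat.lt_or_ge t s with h5 | h5
          · obtain rfl : s = t + 1 := by omega
            rw [hst π h1]; exact hjj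
          · exact h2 s h3 h5
    rw [Finset.sum_congr rfl key]
    have hmem : j0 ∈ Finset.Iic (⟨t, ht⟩ : Fin n) := by
      rw [Finset.mem_Iic, Fin.le_def]
      simp only
      omega
    rw [← Finset.add_sum_erase _ _ hmem, if_pos rfl, zero_add,
      Finset.sum_congr rfl (fun j hj => if_neg (Finset.ne_of_mem_erase hj))]
    rw [Finset.sum_const, Finset.card_erase_of_mem hmem, Fin.card_Iic]
    simp only [Nat.add_sub_cancel, smul_eq_mul]
    rw [← Nat.mul_factorial_pred (show t ≠ 0 by omega)]
    ring

lemma sagree_stop {α : Type*} [Fintype α] [DecidableEq α] {n : ℕ} (k : ℕ) (hk : 1 ≤ k)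
    (stops : (Fin n ≃ α) → ℕ → Prop)
    (b : (Fin n ≃ α) → ℕ → α)
    (hb : ∀ σ π t, SAgree t σ π → b π t = b σ t)
    (hlt : ∀ (π : Fin n ≃ α) (t : ℕ), 1 ≤ t → t ≤ n → (π.symm (b π t) : ℕ) < t)
    (hs : ∀ (π : Fin n ≃ α) (t : ℕ), stops π t ↔ (π.symm (b π t) : ℕ) = t - 1)
    (t : ℕ) (hkt : k < t) (ht : t ≤ n) (σ : Fin n ≃ α) :
    (Finset.univ.filter (fun π : Fin n ≃ α => SAgree t σ π ∧
      (stops π t ∧ ∀ s, k < s → s < t → ¬ stops π s))).card * (t * (t - 1))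
      = k * t.factorial := by
  obtain ⟨t, rfl⟩ : ∃ u, t = u + 1 := ⟨t - 1, by omega⟩
  -- complement: (no stop in k+1..t) = (no stop in k+1..t+1) + (stop at t+1)
  have hA := sagree_nostop k hk stops b hb hlt hs (t + 1) (by omega) ht σ
  have hB : (Finset.univ.filter (fun π : Fin n ≃ α => SAgree (t + 1) σ π ∧
      ∀ s, k < s → s ≤ t → ¬ stops π s)).card = (t + 1) * (k * (t - 1).factorial) := by
    rw [sagree_rec (⟨t, ht⟩ : Fin n) σ, Finset.sum_congr rfl (fun j _ =>
      sagree_nostop k hk stops b hb hlt hs t (by omega) (by omega) _)]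
    simp
  have hsplit := Finset.card_filter_add_card_filter_not
    (s := Finset.univ.filter (fun π : Fin n ≃ α => SAgree (t + 1) σ π ∧
      ∀ s, k < s → s ≤ t → ¬ stops π s)) (fun π => stops π (t + 1))
  rw [Finset.filter_filter, Finset.filter_filter, hB] at hsplit
  have e1 : ∀ π : Fin n ≃ α, ((SAgree (t + 1) σ π ∧ ∀ s, k < s → s ≤ t → ¬ stops π s) ∧
      stops π (t + 1)) ↔ (SAgree (t + 1) σ π ∧
      (stops π (t + 1) ∧ ∀ s, k < s → s < t + 1 → ¬ stops π s)) := by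
    intro π
    simp only [Nat.lt_succ_iff]
    tauto
  have e2 : ∀ π : Fin n ≃ α, ((SAgree (t + 1) σ π ∧ ∀ s, k < s → s ≤ t → ¬ stops π s) ∧
      ¬ stops π (t + 1)) ↔ (SAgree (t + 1) σ π ∧
      ∀ s, k < s → s ≤ t + 1 → ¬ stops π s) := by
    intro π
    constructor
    · rintro ⟨⟨h1, h2⟩, h3⟩
      refine ⟨h1, fun s h4 h5 => ?_⟩
      rcases Nat.lt_or_ge t s with h6 | h6
      · obtain rfl : s = t + 1 := by omega
        exact h3
      · exact h2 s h4 h6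
    · rintro ⟨h1, h2⟩
      exact ⟨⟨h1, fun s h4 h5 => h2 s h4 (by omega)⟩, h2 _ (by omega) le_rfl⟩
  simp only [e1, e2] at hsplit
  rw [hA] at hsplit
  simp only [Nat.add_sub_cancel] at hsplit ⊢
  rw [← Nat.mul_factorial_pred (show t ≠ 0 by omega)] at hsplit
  rw [Nat.factorial_succ, ← Nat.mul_factorial_pred (show t ≠ 0 by omega)]
  have : (Finset.univ.filter (fun π : Fin n ≃ α => SAgree (t + 1) σ π ∧
      (stops π (t + 1) ∧ ∀ s, k < s → s < t + 1 → ¬ stops π s))).card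
      = k * (t - 1).factorial := by
    nlinarith
  rw [this]
  ring

lemma exists_prefix {α : Type*} [Fintype α] [DecidableEq α] {n : ℕ}
    (hcard : Fintype.card α = n) (S : Finset α) :
    ∃ π : Fin n ≃ α, (Finset.univ.filter (fun i : Fin n => (i : ℕ) < S.card)).image π = S := by
  have e : Fin n ≃ α := (Fintype.equivFinOfCardEq hcard).symm
  have hle : S.card ≤ n := hcard ▸ Finset.card_le_univ S
  have hc : Fintype.card {i : Fin n // (i : ℕ) < S.card}
      = Fintype.card {i : Fin n // e i ∈ S} := by
    rw [Fintype.card_congr (e.subtypeEquiv (q := fun x => x ∈ S) (fun a => Iff.rfl))]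
    rw [Fintype.card_coe, Fintype.card_subtype]
    convert (Fin.card_filter_val_lt (n := n) (m := S.card)).trans (min_eq_right hle)
  let f := Fintype.equivOfCardEq hc
  have hsub : (Finset.univ.filter (fun i : Fin n => (i : ℕ) < S.card)).image
      (f.extendSubtype.trans e) ⊆ S := by
    intro x hx
    simp only [Finset.mem_image, Finset.mem_filter, Finset.mem_univ, true_and] at hx
    obtain ⟨i, hi, rfl⟩ := hx
    exact f.extendSubtype_mem i hi
  refine ⟨f.extendSubtype.trans e, Finset.eq_of_subset_of_card_le hsub ?_⟩
  rw [Finset.card_image_of_injective _ (Equiv.injective _)]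
  refine ge_of_eq ?_
  convert (Fin.card_filter_val_lt (n := n) (m := S.card)).trans (min_eq_right hle)

/-- secretary stopping lemma: `n` agents from a finite set `A` arrive in a
uniformly random order (modeled by a uniformly random bijection `π : Fin n ≃ α`, agent
`a_t = π (t-1)` arriving at time `t`).  The rule skips the first `k` arrivals and stops at
the first time `t > k` such that the newly arrived agent is `best` of the prefix set
(`stopT π = n+1` encodes `T = ∞`).  Then for every `k < t ≤ n` and every `t`-element subset
`S ⊆ A`, `Pr[T = t ∣ {a_1,…,a_t} = S] = k/(t(t-1))`. -/
theorem stmt_5 {α : Type*} [Fintype α] [DecidableEq α] (n : ℕ)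
    (hcard : Fintype.card α = n)
    (best : Finset α → α) (hbest : ∀ S : Finset α, S.Nonempty → best S ∈ S)
    (k : ℕ) (hk1 : 1 ≤ k) (hkn : k < n)
    (P : (Fin n ≃ α) → ℕ → Finset α)
    (hP : ∀ π t, P π t = (Finset.univ.filter (fun i : Fin n => (i : ℕ) < t)).image π)
    (stops : (Fin n ≃ α) → ℕ → Prop)
    (hstops : ∀ π t, stops π t ↔ ((π.symm (best (P π t)) : ℕ) = t - 1))
    (stopT : (Fin n ≃ α) → ℕ)
    (hstopT : ∀ π, stopT π =
      if h : ((Finset.Icc (k + 1) n).filter (fun t => stops π t)).Nonempty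
      then ((Finset.Icc (k + 1) n).filter (fun t => stops π t)).min' h
      else n + 1) :
    ∀ t, k < t → t ≤ n → ∀ S : Finset α, S.card = t →
      ((Finset.univ.filter (fun π : Fin n ≃ α => P π t = S ∧ stopT π = t)).card : ℝ) /
          ((Finset.univ.filter (fun π : Fin n ≃ α => P π t = S)).card : ℝ)
        = (k : ℝ) / ((t : ℝ) * ((t : ℝ) - 1)) := by
  have hmemP : ∀ (π : Fin n ≃ α) (t : ℕ) (x : α), x ∈ P π t ↔ (π.symm x : ℕ) < t := by
    intro π t x
    rw [hP]
    simp only [Finset.mem_image, Finset.mem_filter, Finset.mem_univ, true_and]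
    constructor
    · rintro ⟨i, hi, rfl⟩
      simpa using hi
    · intro h
      exact ⟨π.symm x, h, by simp⟩
  have hPag : ∀ σ π t, SAgree t σ π → P π t = P σ t := by
    intro σ π t h
    ext x
    rw [hmemP, hmemP]
    exact ⟨h.aux x, h.symm'.aux x⟩
  intro t hkt htn S hS
  have hT : ∀ π, stopT π = t ↔ (stops π t ∧ ∀ s, k < s → s < t → ¬ stops π s) := by
    intro π
    rw [hstopT]
    constructor
    · intro h
      split_ifs at h with hne
      · have hm := Finset.min'_mem _ hne
        rw [h] at hm
        refine ⟨(Finset.mem_filter.mp hm).2, fun s h1 h2 h3 => ?_⟩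
        have := Finset.min'_le ((Finset.Icc (k + 1) n).filter (fun t => stops π t)) s
          (Finset.mem_filter.mpr ⟨Finset.mem_Icc.mpr ⟨by omega, by omega⟩, h3⟩)
        omega
      · omega
    · rintro ⟨h1, h2⟩
      have hm : t ∈ (Finset.Icc (k + 1) n).filter (fun t => stops π t) :=
        Finset.mem_filter.mpr ⟨Finset.mem_Icc.mpr ⟨by omega, by omega⟩, h1⟩
      rw [dif_pos ⟨t, hm⟩]
      apply le_antisymm (Finset.min'_le _ _ hm)
      apply Finset.le_min'
      intro s hs
      rw [Finset.mem_filter, Finset.mem_Icc] at hs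
      by_contra hc
      exact h2 s (by omega) (by omega) hs.2
  have hcnt := sagree_stop k hk1 stops (fun π t => best (P π t))
    (fun σ π t h => by simp only [hPag σ π t h])
    (fun π t h1 h2 => by
      rw [← hmemP]
      apply hbest
      exact ⟨π ⟨0, by omega⟩, by rw [hmemP]; simp; omega⟩)
    hstops t hkt htn
  set N := Finset.univ.filter (fun π : Fin n ≃ α => P π t = S ∧ stopT π = t) with hN
  set E := Finset.univ.filter (fun π : Fin n ≃ α => P π t = S) with hE
  have hdc : ∑ σ ∈ E, (N.filter (fun π => SAgree t σ π)).card
      = ∑ π ∈ N, (E.filter (fun σ => SAgree t σ π)).card :=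
    Finset.sum_card_bipartiteAbove_eq_sum_card_bipartiteBelow _
  have h1 : ∀ σ ∈ E, (N.filter (fun π => SAgree t σ π)).card * (t * (t - 1))
      = k * t.factorial := by
    intro σ hσ
    rw [← hcnt σ]
    congr 2
    ext π
    have hσ' : P σ t = S := by simpa [hE] using hσ
    simp only [hN, Finset.mem_filter, Finset.mem_univ, true_and, hT]
    constructor
    · rintro ⟨⟨_, a⟩, b⟩
      exact ⟨b, a⟩
    · rintro ⟨b, a⟩
      exact ⟨⟨(hPag σ π t b).trans hσ', a⟩, b⟩
  have h2 : ∀ π ∈ N, (E.filter (fun σ => SAgree t σ π)).card = t.factorial := by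
    intro π hπ
    rw [← sagree_card t htn π]
    congr 1
    ext σ
    have hπ' : P π t = S := by
      rw [hN, Finset.mem_filter] at hπ
      exact hπ.2.1
    simp only [hE, Finset.mem_filter, Finset.mem_univ, true_and]
    constructor
    · rintro ⟨_, b⟩
      exact b.symm'
    · intro b
      exact ⟨(hPag π σ t b).trans hπ', b.symm'⟩
  rw [Finset.sum_congr rfl h2, Finset.sum_const, smul_eq_mul] at hdc
  have hmain : N.card * (t * (t - 1)) = E.card * k := by
    have h3 : N.card * t.factorial * (t * (t - 1)) = E.card * (k * t.factorial) := by
      rw [← hdc, Finset.sum_mul, Finset.sum_congr rfl h1, Finset.sum_const, smul_eq_mul]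
    apply Nat.eq_of_mul_eq_mul_right (Nat.factorial_pos t)
    calc _ = N.card * t.factorial * (t * (t - 1)) := by ring
      _ = _ := by rw [h3]; ring
  have hEpos : (E.card : ℝ) ≠ 0 := by
    obtain ⟨π, hπ⟩ := exists_prefix hcard S
    have : π ∈ E := by
      rw [hE, Finset.mem_filter]
      refine ⟨Finset.mem_univ _, ?_⟩
      rw [hP, ← hS]
      exact hπ
    exact_mod_cast (Finset.card_pos.mpr ⟨π, this⟩).ne'
  have ht1 : (t : ℝ) - 1 ≠ 0 := by
    have : (2 : ℝ) ≤ t := by exact_mod_cast (by omega : 2 ≤ t)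
    linarith
  have ht0 : (t : ℝ) ≠ 0 := by exact_mod_cast (by omega : t ≠ 0)
  rw [div_eq_div_iff hEpos (mul_ne_zero ht0 ht1)]
  have hR : ((N.card * (t * (t - 1)) : ℕ) : ℝ) = ((E.card * k : ℕ) : ℝ) := by rw [hmain]
  rw [Nat.cast_mul, Nat.cast_mul, Nat.cast_mul, Nat.cast_sub (by omega), Nat.cast_one] at hR
  rw [hR]
  ring
end

section
/- For every ε > 0 there exists N such that the following holds for all n ≥ N. Let A be a set of n agents, each agent a ∈ A having a fixed signal s̄_a ∈ ℝ≥0 and a valuation function v̄_a : ℝ≥0^A → ℝ≥0 that is monotone and subadditive over signals; for X ⊆ A let s̄_X denote the profile equal to s̄ on X and 0 elsewhere. Let a_1, …, a_n be a uniformly random ordering of A and A_t = {a_1, …, a_t}. Fix any linear order on A for tie-breaking and let T be the least t > ⌊n/e⌋ such that a_t maximizes v̄_a(s̄_{A_t}) over a ∈ A_t (ties broken by the fixed order), with T = ∞ if no such t exists. Then the expected myopic welfare satisfies E[1[T ≤ n] · v̄_{a_T}(s̄_{A_T})] ≥ (1/(2e) − ε) · max_{a∈A} v̄_a(s̄). 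-/
open Finset

attribute [local instance] Classical.propDecidable

/-- The set of the first `t` arrivals. -/
def pre {n : ℕ} (π : Equiv.Perm (Fin n)) (t : ℕ) : Finset (Fin n) :=
  (Finset.univ.filter fun i : Fin n => (i : ℕ) < t).image π

/-- Invariance under transpositions of the first `t` positions. -/
def SwapInv {n : ℕ} {β : Type*} (t : ℕ) (f : Equiv.Perm (Fin n) → β) : Prop :=
  ∀ i j : Fin n, (i : ℕ) < t → (j : ℕ) < t → ∀ π, f (π * Equiv.swap i j) = f π

lemma mem_pre {n : ℕ} (π : Equiv.Perm (Fin n)) (t : ℕ) (a : Fin n) :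
    a ∈ pre π t ↔ ((π.symm a : Fin n) : ℕ) < t := by
  unfold pre
  simp only [Finset.mem_image, Finset.mem_filter, Finset.mem_univ, true_and]
  constructor
  · rintro ⟨i, hi, rfl⟩
    simpa using hi
  · intro h
    exact ⟨π.symm a, h, by simp⟩

lemma swap_lt {n : ℕ} (t : ℕ) (i j x : Fin n) (hi : (i : ℕ) < t) (hj : (j : ℕ) < t) :
    ((Equiv.swap i j x : Fin n) : ℕ) < t ↔ (x : ℕ) < t := by
  by_cases h1 : x = i
  · subst h1; simp [hi, hj]
  · by_cases h2 : x = j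
    · subst h2; simp [hi, hj]
    · rw [Equiv.swap_apply_of_ne_of_ne h1 h2]

lemma pre_inv {n : ℕ} (t : ℕ) : SwapInv t (fun π : Equiv.Perm (Fin n) => pre π t) := by
  intro i j hi hj π
  ext a
  simp only [mem_pre]
  have : (π * Equiv.swap i j).symm a = Equiv.swap i j (π.symm a) := by
    rw [Equiv.symm_apply_eq]
    simp
  rw [this, swap_lt t i j _ hi hj]

lemma SwapInv.mono {n : ℕ} {β : Type*} {s t : ℕ} {f : Equiv.Perm (Fin n) → β}
    (h : SwapInv t f) (hst : s ≤ t) : SwapInv s f :=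
  fun i j hi hj π => h i j (lt_of_lt_of_le hi hst) (lt_of_lt_of_le hj hst) π

lemma card_lt_fin {n t : ℕ} (ht : t ≤ n) :
    (Finset.univ.filter fun i : Fin n => (i : ℕ) < t).card = t := by
  have h := Fin.card_filter_val_lt (m := t) (n := n)
  rw [min_eq_right ht] at h
  convert h using 2

/-- Symmetrization over the first `t` positions. -/
lemma sym_sum {n t : ℕ} (ht : t ≤ n) (f : Equiv.Perm (Fin n) → ℝ)
    (b : Equiv.Perm (Fin n) → Fin n) (hf : SwapInv t f) (hb : SwapInv t b)
    (i : Fin n) (hi : (i : ℕ) < t) :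
    (t : ℝ) * ∑ π, (if π i = b π then f π else 0)
      = ∑ π, (if b π ∈ pre π t then f π else 0) := by
  have h1 : ∀ j : Fin n, (j : ℕ) < t →
      ∑ π, (if π j = b π then f π else 0) = ∑ π, (if π i = b π then f π else 0) := by
    intro j hj
    rw [← Equiv.sum_comp (Equiv.mulRight (Equiv.swap i j))]
    refine Finset.sum_congr rfl fun π _ => ?_
    simp only [Equiv.coe_mulRight, hf i j hi hj π, hb i j hi hj π, Equiv.Perm.mul_apply,
      Equiv.swap_apply_right]
  have h2 : ∀ π : Equiv.Perm (Fin n),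
      ∑ j ∈ Finset.univ.filter (fun j : Fin n => (j : ℕ) < t), (if π j = b π then f π else 0)
        = if b π ∈ pre π t then f π else 0 := by
    intro π
    have : ∀ j, (π j = b π) = (j = π.symm (b π)) := fun j => by
      rw [Equiv.eq_symm_apply]
    simp only [this, mem_pre]
    rw [Finset.sum_ite_eq']
    simp
  rw [← Finset.sum_congr rfl (fun π _ => h2 π), Finset.sum_comm,
    Finset.sum_congr rfl (fun j hj => h1 j (Finset.mem_filter.1 hj).2), Finset.sum_const,
    card_lt_fin ht, nsmul_eq_mul]

lemma best_sum {n t : ℕ} (ht : t < n) (f : Equiv.Perm (Fin n) → ℝ)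
    (best : Finset (Fin n) → Fin n) (hbest : ∀ X, X.Nonempty → best X ∈ X)
    (hf : SwapInv (t + 1) f) :
    ((t : ℝ) + 1) * ∑ π : Equiv.Perm (Fin n),
      (if π ⟨t, ht⟩ = best (pre π (t + 1)) then f π else 0) = ∑ π, f π := by
  have h := sym_sum (t := t + 1) ht f (fun π => best (pre π (t + 1))) hf
    (fun i j hi hj π => congrArg best (pre_inv (t + 1) i j hi hj π)) ⟨t, ht⟩ (by simp)
  push_cast at h
  rw [h]
  refine Finset.sum_congr rfl fun π _ => ?_
  rw [if_pos]
  apply hbest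
  exact ⟨π ⟨t, ht⟩, by simp [mem_pre]⟩

lemma step_inv {n t : ℕ} (ht : t < n) (f : Equiv.Perm (Fin n) → ℝ)
    (best : Finset (Fin n) → Fin n) (hf : SwapInv (t + 1) f) :
    SwapInv t (fun π : Equiv.Perm (Fin n) =>
      if π ⟨t, ht⟩ = best (pre π (t + 1)) then f π else 0) := by
  intro i j hi hj π
  have e1 := pre_inv (t + 1) i j (by omega) (by omega) π
  have e2 := hf i j (by omega) (by omega) π
  simp only at e1
  have e3 : (π * Equiv.swap i j) ⟨t, ht⟩ = π ⟨t, ht⟩ := by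
    rw [Equiv.Perm.mul_apply, Equiv.swap_apply_of_ne_of_ne]
    · intro h; rw [← h] at hi; simp at hi
    · intro h; rw [← h] at hj; simp at hj
  simp only [e1, e2, e3]

lemma nostop_sum {n k : ℕ} (hk : 1 ≤ k)
    (best : Finset (Fin n) → Fin n) (hbest : ∀ X, X.Nonempty → best X ∈ X)
    (stops : Equiv.Perm (Fin n) → ℕ → Prop)
    (hs : ∀ π t, ∀ ht : t < n, stops π (t + 1) ↔ π ⟨t, ht⟩ = best (pre π (t + 1)))
    (t : ℕ) (hkt : k ≤ t) : t ≤ n → ∀ f : Equiv.Perm (Fin n) → ℝ, SwapInv t f →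
    (t : ℝ) * ∑ π, (if ∀ s, k < s → s ≤ t → ¬ stops π s then f π else 0)
      = k * ∑ π, f π := by
  induction t, hkt using Nat.le_induction with
  | base =>
    intro _ f _
    congr 1
    refine Finset.sum_congr rfl fun π _ => ?_
    rw [if_pos]
    intro s h1 h2
    omega
  | succ t hkt ih =>
    intro htn f hf
    have ht : t < n := htn
    have hinv := step_inv ht f best hf
    have hA := ih ht.le f (hf.mono (Nat.le_succ t))
    have hB := ih ht.le _ hinv
    have hC := best_sum ht f best hbest hf
    have hsplit : ∑ π, (if ∀ s, k < s → s ≤ t + 1 → ¬ stops π s then f π else 0)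
        = ∑ π, (if ∀ s, k < s → s ≤ t → ¬ stops π s then f π else 0)
          - ∑ π, (if ∀ s, k < s → s ≤ t → ¬ stops π s then
              (if π ⟨t, ht⟩ = best (pre π (t + 1)) then f π else 0) else 0) := by
      rw [← Finset.sum_sub_distrib]
      refine Finset.sum_congr rfl fun π _ => ?_
      by_cases h1 : ∀ s, k < s → s ≤ t → ¬ stops π s
      · by_cases h2 : stops π (t + 1)
        · have h3 := (hs π t ht).1 h2
          rw [if_neg (fun h => h (t + 1) (by omega) le_rfl h2), if_pos h1, if_pos h1, if_pos h3]
          ring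
        · have h3 := fun h => h2 ((hs π t ht).2 h)
          rw [if_pos, if_pos h1, if_pos h1, if_neg h3]
          · ring
          · intro s hs1 hs2
            rcases Nat.lt_or_ge s (t + 1) with h | h
            · exact h1 s hs1 (by omega)
            · have : s = t + 1 := by omega
              rw [this]; exact h2
      · rw [if_neg (fun h => h1 fun s a b => h s a (by omega)), if_neg h1, if_neg h1]
        ring
    rw [hsplit]
    have ht0 : (t : ℝ) ≠ 0 := by
      have : 0 < t := by omega
      positivity
    push_cast
    apply mul_left_cancel₀ ht0
    have : (t : ℝ) * (((t : ℝ) + 1) * (∑ π, (if ∀ s, k < s → s ≤ t → ¬ stops π s then f π else 0)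
          - ∑ π, (if ∀ s, k < s → s ≤ t → ¬ stops π s then
              (if π ⟨t, ht⟩ = best (pre π (t + 1)) then f π else 0) else 0)))
        = ((t : ℝ) + 1) * (k * ∑ π, f π) - ((t : ℝ) + 1) * (k * ∑ π : Equiv.Perm (Fin n),
          (if π ⟨t, ht⟩ = best (pre π (t + 1)) then f π else 0)) := by
      rw [← hA, ← hB]; ring
    rw [this]
    linear_combination (-(k : ℝ)) * hC

/-- The numerical heart: the lower half of the window is outweighed by its top part. -/
lemma num_sum {n k : ℕ} (H : ℕ → ℝ) (hmono : Monotone H)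
    (hsym : ∀ t, t < n → 0 ≤ H t + H (n - 1 - t)) (hk : 1 ≤ k) (hkn : 2 * k + 1 < n)
    (hnum : (n : ℝ) * (n / 2 - k) ≤ k * (k + 1)) :
    0 ≤ ∑ t ∈ Finset.Ico k n, H t / t := by
  by_cases hpos : 0 ≤ H k
  · refine Finset.sum_nonneg fun t ht => ?_
    have := hmono (Finset.mem_Ico.1 ht).1
    exact div_nonneg (hpos.trans this) (by positivity)
  push Not at hpos
  set m := n / 2 with hm
  have hkm : k ≤ m := by omega
  have hmn : m ≤ n - 1 - k := by omega
  have hkR : (0 : ℝ) < k := by exact_mod_cast hk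
  have hnR : (0 : ℝ) < n := by
    have : 0 < n := by omega
    exact_mod_cast this
  rw [← Finset.sum_Ico_consecutive _ hkm (by omega : m ≤ n),
    ← Finset.sum_Ico_consecutive _ hmn (by omega : n - 1 - k ≤ n)]
  have b1 : ((m : ℝ) - k) * (H k / k) ≤ ∑ t ∈ Finset.Ico k m, H t / t := by
    have := Finset.card_nsmul_le_sum (Finset.Ico k m) (fun t : ℕ => H t / t) (H k / k) ?_
    · rw [Nat.card_Ico, nsmul_eq_mul, Nat.cast_sub hkm] at this
      exact this
    · intro t ht
      have ht1 := (Finset.mem_Ico.1 ht).1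
      have htk : (k : ℝ) ≤ t := by exact_mod_cast ht1
      have h1 : H k / k ≤ H k / t := by
        rw [div_le_div_iff₀ hkR (by linarith)]
        nlinarith
      exact h1.trans (div_le_div_of_nonneg_right (hmono ht1) (by positivity))
  have b2 : 0 ≤ ∑ t ∈ Finset.Ico m (n - 1 - k), H t / t := by
    refine Finset.sum_nonneg fun t ht => ?_
    have ht1 := Finset.mem_Ico.1 ht
    have h1 := hsym t (by omega)
    have h2 : H (n - 1 - t) ≤ H t := hmono (by omega)
    exact div_nonneg (by linarith) (by positivity)
  have b3 : ((k : ℝ) + 1) * (-H k / n) ≤ ∑ t ∈ Finset.Ico (n - 1 - k) n, H t / t := by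
    have := Finset.card_nsmul_le_sum (Finset.Ico (n - 1 - k) n) (fun t : ℕ => H t / t) (-H k / n) ?_
    · rw [Nat.card_Ico, nsmul_eq_mul] at this
      have e : n - (n - 1 - k) = k + 1 := by omega
      rw [e] at this
      push_cast at this
      exact this
    · intro t ht
      have ht1 := Finset.mem_Ico.1 ht
      have h1 := hsym k (by omega)
      have h2 : H (n - 1 - k) ≤ H t := hmono ht1.1
      have htn : (t : ℝ) ≤ n := by exact_mod_cast ht1.2.le
      have ht0 : (0 : ℝ) < t := by
        have : 0 < t := by omega
        exact_mod_cast this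
      rw [div_le_div_iff₀ hnR ht0]
      nlinarith
  have hm2 : (m : ℝ) ≤ n / 2 := by
    rw [hm]; exact Nat.cast_div_le
  have key : ((m : ℝ) - k) / k ≤ (k + 1) / n := by
    rw [div_le_div_iff₀ hkR hnR]
    nlinarith
  have : 0 ≤ ((m : ℝ) - k) * (H k / k) + ((k : ℝ) + 1) * (-H k / n) := by
    have e : ((m : ℝ) - k) * (H k / k) + ((k : ℝ) + 1) * (-H k / n)
      = (-H k) * ((k + 1) / n - ((m : ℝ) - k) / k) := by ring
    rw [e]
    exact mul_nonneg (by linarith) (by linarith)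
  linarith

lemma harm_sum {n k : ℕ} (hk : 1 ≤ k) (hkn : k ≤ n) (hke : (k : ℝ) ≤ n / Real.exp 1) :
    1 ≤ ∑ t ∈ Finset.Ico k n, 1 / (t : ℝ) := by
  have h : Real.log n - Real.log k ≤ ∑ t ∈ Finset.Ico k n, 1 / (t : ℝ) := by
    rw [← Finset.sum_Ico_sub (fun t : ℕ => Real.log t) hkn]
    refine Finset.sum_le_sum fun t ht => ?_
    have ht0 : (0 : ℝ) < t := by
      have := (Finset.mem_Ico.1 ht).1
      have : 0 < t := by omega
      exact_mod_cast this
    rw [← Real.log_div (by positivity) (by positivity)]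
    refine (Real.log_le_sub_one_of_pos (by positivity)).trans (le_of_eq ?_)
    push_cast
    field_simp
    ring
  have hkR : (0 : ℝ) < k := by exact_mod_cast hk
  have hnR : (0 : ℝ) < n := by
    have : 0 < n := by omega
    exact_mod_cast this
  have := Real.log_le_log hkR hke
  rw [Real.log_div hnR.ne' (Real.exp_ne_zero 1), Real.log_exp] at this
  linarith

/-- Existence of a lexicographically best agent in every nonempty set. -/
lemma exists_best {n : ℕ} (w : Fin n → NNReal) (rank : Fin n → ℕ) (hrank : Function.Injective rank)
    (X : Finset (Fin n)) (hX : X.Nonempty) :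
    ∃ b ∈ X, ∀ a ∈ X, a ≠ b → (w a < w b ∨ (w a = w b ∧ rank b < rank a)) := by
  obtain ⟨b, hb, hmax⟩ := Finset.exists_max_image X
    (fun a => toLex (w a, OrderDual.toDual (rank a))) hX
  refine ⟨b, hb, fun a ha hab => ?_⟩
  have h := hmax a ha
  rw [Prod.Lex.le_iff] at h
  simp only [ofLex_toLex, OrderDual.toDual_le_toDual] at h
  rcases h with h | ⟨h1, h2⟩
  · exact Or.inl h
  · exact Or.inr ⟨h1, lt_of_le_of_ne h2 fun h => hab (hrank h.symm)⟩

/-- Conditional sum over orders in which agent `a` arrives first. -/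
noncomputable def condSum {n : ℕ} [NeZero n] (a : Fin n) (u : Finset (Fin n) → ℝ) (t : ℕ) : ℝ :=
  ∑ π : Equiv.Perm (Fin n), if π 0 = a then u (pre π t) else 0

lemma condSum_mono {n : ℕ} [NeZero n] (a : Fin n) (u : Finset (Fin n) → ℝ)
    (hu : ∀ X Y, X ⊆ Y → u X ≤ u Y) : Monotone (condSum a u) := by
  intro s t hst
  refine Finset.sum_le_sum fun π _ => ?_
  split_ifs
  · apply hu
    intro x hx
    rw [mem_pre] at hx ⊢
    omega
  · exact le_rfl

lemma card_cond {n : ℕ} [NeZero n] (a : Fin n) (c : ℝ) :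
    (n : ℝ) * ∑ π : Equiv.Perm (Fin n), (if π 0 = a then c else 0) = (n.factorial : ℝ) * c := by
  have h := sym_sum (n := n) (t := n) le_rfl (fun _ => c) (fun _ => a)
    (fun _ _ _ _ _ => rfl) (fun _ _ _ _ _ => rfl) 0 (Fin.is_lt _)
  rw [h]
  have : ∀ π : Equiv.Perm (Fin n), a ∈ pre π n := fun π => by
    rw [mem_pre]; exact Fin.is_lt _
  simp only [this, if_true, Finset.sum_const, nsmul_eq_mul, Finset.card_univ, Fintype.card_perm,
    Fintype.card_fin]

lemma condSum_sym {n : ℕ} [NeZero n] (a : Fin n) (u : Finset (Fin n) → ℝ) (c : ℝ)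
    (hu : ∀ X Y, X ∪ Y = Finset.univ → c ≤ u X + u Y) (t : ℕ) (ht : t < n) :
    ∑ π : Equiv.Perm (Fin n), (if π 0 = a then c else 0)
      ≤ condSum a u (t + 1) + condSum a u (n - 1 - t + 1) := by
  have e : condSum a u (n - 1 - t + 1) = ∑ π : Equiv.Perm (Fin n),
      if π 0 = a then u (pre (π * Equiv.neg (Fin n)) (n - 1 - t + 1)) else 0 := by
    unfold condSum
    rw [← Equiv.sum_comp (Equiv.mulRight (Equiv.neg (Fin n)))]
    refine Finset.sum_congr rfl fun π _ => ?_
    simp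
  rw [e]
  unfold condSum
  rw [← Finset.sum_add_distrib]
  refine Finset.sum_le_sum fun π _ => ?_
  split_ifs
  · apply hu
    ext x
    simp only [Finset.mem_union, mem_pre, Finset.mem_univ, iff_true]
    have h1 : (π * Equiv.neg (Fin n)).symm x = -(π.symm x) := by
      rw [Equiv.symm_apply_eq]
      simp
    rw [h1]
    by_cases h : ((π.symm x : Fin n) : ℕ) < t + 1
    · exact Or.inl h
    · right
      rw [Fin.val_neg']
      have := (π.symm x).is_lt
      rw [Nat.mod_eq_of_lt (by omega)]
      omega
  · simp

lemma k_bounds (n : ℕ) (hn : 1000 ≤ n) :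
    1 ≤ ⌊(n : ℝ) / Real.exp 1⌋₊ ∧ 2 * ⌊(n : ℝ) / Real.exp 1⌋₊ + 1 < n ∧
    (n : ℝ) * (n / 2 - ⌊(n : ℝ) / Real.exp 1⌋₊) ≤
      ⌊(n : ℝ) / Real.exp 1⌋₊ * (⌊(n : ℝ) / Real.exp 1⌋₊ + 1) := by
  have he1 := Real.exp_one_gt_d9
  have he2 := Real.exp_one_lt_d9
  have hnR : (1000 : ℝ) ≤ n := by exact_mod_cast hn
  have hlo : (0.3678 : ℝ) * n ≤ n / Real.exp 1 := by
    rw [le_div_iff₀ (by positivity)]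
    nlinarith
  have hhi : (n : ℝ) / Real.exp 1 ≤ 0.4 * n := by
    rw [div_le_iff₀ (by positivity)]
    nlinarith
  have hf1 := Nat.floor_le (show (0 : ℝ) ≤ n / Real.exp 1 by positivity)
  have hf2 := Nat.lt_floor_add_one ((n : ℝ) / Real.exp 1)
  set k := ⌊(n : ℝ) / Real.exp 1⌋₊
  refine ⟨?_, ?_, ?_⟩
  · have : (0 : ℝ) < k := by linarith
    exact_mod_cast this
  · have : (2 * k + 1 : ℝ) < n := by linarith
    exact_mod_cast this
  · have h : (0.3678 : ℝ) * n - 1 ≤ k := by linarith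
    have h0 : (0 : ℝ) ≤ 0.3678 * n - 1 := by linarith
    have h3 : (0.3678 * (n : ℝ) - 1) * (0.3678 * n) ≤ k * (k + 1) :=
      mul_le_mul h (by linarith) (by linarith) (by linarith)
    nlinarith

/-- secretary algorithm, 2e-approximation, asymptotic form: for every
`ε > 0` there is `N` such that for every `n ≥ N`, fixed signals `s̄` and monotone,
subadditive-over-signals valuations `v̄` on `n` agents, an arbitrary injective tie-breaking
rank, and a uniformly random arrival order `π` (agent `arr π t = π (t-1)` arrives at time
`t`, `A π t` is the set of the first `t` arrivals, `mask X` zeroes out all signals outside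
`X`), the rule stopping at the least `t > ⌊n/e⌋` at which the newly arrived agent strictly
lexicographically (value, then rank) dominates every other agent of the prefix obtains
expected myopic welfare at least `(1/(2e) - ε) · max_a v̄_a(s̄)`. -/
theorem stmt_7 :
    ∀ ε : ℝ, 0 < ε → ∃ N : ℕ, ∀ n : ℕ, N ≤ n →
    ∀ (sbar : Fin n → NNReal) (vbar : Fin n → (Fin n → NNReal) → NNReal),
      (∀ a, Monotone (vbar a)) →
      (∀ a (σ : Fin n → NNReal) (X : Finset (Fin n)),
        vbar a σ ≤ vbar a (fun j => if j ∈ X then σ j else 0)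
          + vbar a (fun j => if j ∉ X then σ j else 0)) →
    ∀ rank : Fin n → ℕ, Function.Injective rank →
    ∀ mask : Finset (Fin n) → Fin n → NNReal,
      (∀ X j, mask X j = if j ∈ X then sbar j else 0) →
    ∀ A : Equiv.Perm (Fin n) → ℕ → Finset (Fin n),
      (∀ π t, A π t = (Finset.univ.filter fun i : Fin n => (i : ℕ) < t).image π) →
    ∀ arr : Equiv.Perm (Fin n) → ℕ → Fin n,
      (∀ (π : Equiv.Perm (Fin n)) (t : ℕ), 1 ≤ t → t ≤ n → ((π.symm (arr π t) : ℕ) = t - 1)) →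
    ∀ stops : Equiv.Perm (Fin n) → ℕ → Prop,
      (∀ π t, stops π t ↔ ∀ a ∈ A π t, a ≠ arr π t →
        (vbar a (mask (A π t)) < vbar (arr π t) (mask (A π t)) ∨
          (vbar a (mask (A π t)) = vbar (arr π t) (mask (A π t)) ∧
            rank (arr π t) < rank a))) →
    ∀ stopT : Equiv.Perm (Fin n) → ℕ,
      (∀ π, stopT π =
        if h : ((Finset.Ioc ⌊(n : ℝ) / Real.exp 1⌋₊ n).filter fun t => stops π t).Nonempty
        then ((Finset.Ioc ⌊(n : ℝ) / Real.exp 1⌋₊ n).filter fun t => stops π t).min' h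
        else n + 1) →
    ∀ payoff : Equiv.Perm (Fin n) → ℝ,
      (∀ π, payoff π = if stopT π ≤ n
        then ((vbar (arr π (stopT π)) (mask (A π (stopT π))) : NNReal) : ℝ) else 0) →
      (1 / (2 * Real.exp 1) - ε) * ((Finset.univ.sup fun a => vbar a sbar : NNReal) : ℝ) ≤
        (∑ π : Equiv.Perm (Fin n), payoff π) / (Nat.factorial n : ℝ) := by
  
  intro ε hε
  refine ⟨max 1000 ⌈1 / ε⌉₊, ?_⟩
  intro n hn sbar vbar hmono hsub rank hrank mask hmask A hA arr harr stops hstops stopT hstopT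
    payoff hpayoff
  have hn1 : 1000 ≤ n := le_trans (le_max_left _ _) hn
  have hn2 : 1 / ε ≤ n := (Nat.le_ceil _).trans (by exact_mod_cast (le_max_right _ _).trans hn)
  have : NeZero n := ⟨by omega⟩
  obtain ⟨hk1, hk2, hk3⟩ := k_bounds n hn1
  have hke := Nat.floor_le (show (0 : ℝ) ≤ n / Real.exp 1 by positivity)
  have hke2 := Nat.lt_floor_add_one ((n : ℝ) / Real.exp 1)
  generalize hkdef : ⌊(n : ℝ) / Real.exp 1⌋₊ = k at *
  have hA' : ∀ π t, A π t = pre π t := hA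
  have harr' : ∀ π t (ht : t < n), arr π (t + 1) = π ⟨t, ht⟩ := by
    intro π t ht
    have h := harr π (t + 1) (by omega) (by omega)
    rw [← Equiv.symm_apply_eq]
    ext
    simpa using h
  -- the best agent
  have hex := fun X : Finset (Fin n) => exists_best (fun a => vbar a (mask X)) rank hrank X
  let best : Finset (Fin n) → Fin n := fun X => if h : X.Nonempty then (hex X h).choose else 0
  have hbest1 : ∀ X, X.Nonempty → best X ∈ X := by
    intro X h
    simp only [best, dif_pos h]
    exact (hex X h).choose_spec.1
  have hbest2 : ∀ X, X.Nonempty → ∀ a ∈ X, a ≠ best X → (vbar a (mask X) < vbar (best X) (mask X) ∨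
      (vbar a (mask X) = vbar (best X) (mask X) ∧ rank (best X) < rank a)) := by
    intro X h
    simp only [best, dif_pos h]
    exact (hex X h).choose_spec.2
  have hs : ∀ π t, ∀ ht : t < n, stops π (t + 1) ↔ π ⟨t, ht⟩ = best (pre π (t + 1)) := by
    intro π t ht
    have hmem : π ⟨t, ht⟩ ∈ pre π (t + 1) := by simp [mem_pre]
    have hne : (pre π (t + 1)).Nonempty := ⟨_, hmem⟩
    rw [hstops, hA', harr' π t ht]
    constructor
    · intro h
      by_contra hcon
      have h1 := h _ (hbest1 _ hne) (Ne.symm hcon)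
      have h2 := hbest2 _ hne _ hmem hcon
      rcases h1 with h1 | ⟨h1, h1'⟩ <;> rcases h2 with h2 | ⟨h2, h2'⟩
      · exact absurd h1 (not_lt.2 h2.le)
      · rw [h2] at h1; exact lt_irrefl _ h1
      · rw [h1] at h2; exact lt_irrefl _ h2
      · omega
    · intro h
      rw [h]
      exact hbest2 _ hne
  -- the optimal agent
  obtain ⟨a, -, ha⟩ := Finset.exists_mem_eq_sup (Finset.univ : Finset (Fin n))
    ⟨0, Finset.mem_univ _⟩ (fun a => vbar a sbar)
  rw [ha]
  let u : Finset (Fin n) → ℝ := fun X => (vbar a (mask X) : ℝ)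
  have hu0 : ∀ X, 0 ≤ u X := fun X => NNReal.coe_nonneg _
  have humono : ∀ X Y, X ⊆ Y → u X ≤ u Y := by
    intro X Y hXY
    apply NNReal.coe_le_coe.2
    apply hmono a
    intro j
    rw [hmask, hmask]
    by_cases h : j ∈ X
    · rw [if_pos h, if_pos (hXY h)]
    · rw [if_neg h]; exact zero_le
  have husub : ∀ X Y, X ∪ Y = Finset.univ → (vbar a sbar : ℝ) ≤ u X + u Y := by
    intro X Y hXY
    have h1 := hsub a sbar X
    have e1 : (fun j => if j ∈ X then sbar j else 0) = mask X := funext fun j => (hmask X j).symm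
    have h2 : vbar a (fun j => if j ∉ X then sbar j else 0) ≤ vbar a (mask Y) := by
      apply hmono a
      intro j
      rw [hmask]
      by_cases h : j ∈ X
      · simp [h]
      · have : j ∈ Y := by
          have := Finset.mem_univ j
          rw [← hXY, Finset.mem_union] at this
          exact this.resolve_left h
        simp [h, this]
    rw [e1] at h1
    have h3 := h1.trans (add_le_add_right h2 _)
    exact_mod_cast h3
  -- pointwise lower bound on the payoff
  let f : ℕ → Equiv.Perm (Fin n) → ℝ := fun t π => if a ∈ pre π t then u (pre π t) else 0
  have hf0 : ∀ t π, 0 ≤ f t π := by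
    intro t π
    simp only [f]
    split_ifs
    · exact hu0 _
    · exact le_rfl
  have hfinv : ∀ t, SwapInv t (f t) := by
    intro t i j hi hj π
    have e := pre_inv t i j hi hj π
    simp only at e
    simp only [f, e]
  have hpay : ∀ π, ∑ t ∈ Finset.Ico k n, (if ∀ s, k < s → s ≤ t → ¬ stops π s then
      (if stops π (t + 1) then f (t + 1) π else 0) else 0) ≤ payoff π := by
    intro π
    rw [hpayoff]
    by_cases hne : ((Finset.Ioc k n).filter fun t => stops π t).Nonempty
    · have hT := hstopT π
      rw [dif_pos hne] at hT
      have hmem := Finset.min'_mem _ hne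
      have hmin : ∀ s ∈ (Finset.Ioc k n).filter (fun t => stops π t), stopT π ≤ s := fun s hs => by
        rw [hT]; exact Finset.min'_le _ s hs
      rw [← hT] at hmem
      rw [Finset.mem_filter, Finset.mem_Ioc] at hmem
      obtain ⟨⟨hT1, hT2⟩, hT3⟩ := hmem
      rw [if_pos hT2]
      obtain ⟨T, hTT⟩ : ∃ T, stopT π = T + 1 := ⟨stopT π - 1, by omega⟩
      rw [hTT] at hT1 hT2 hT3 ⊢
      simp only [hTT] at hmin
      rw [Finset.sum_eq_single T]
      · have hle : f (T + 1) π ≤ (vbar (arr π (T + 1)) (mask (A π (T + 1))) : ℝ) := by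
          simp only [f]
          split_ifs with hmem
          · rw [hA']
            apply NNReal.coe_le_coe.2
            by_cases hc : a = arr π (T + 1)
            · rw [← hc]
            · have h := (hstops π (T + 1)).1 hT3 a (by rw [hA']; exact hmem) hc
              rw [hA'] at h
              rcases h with h | ⟨h, -⟩
              · exact h.le
              · exact h.le
          · exact NNReal.coe_nonneg _
        split_ifs
        · exact hle
        · exact NNReal.coe_nonneg _
      · intro t ht htT
        have ht' := Finset.mem_Ico.1 ht
        by_cases h1 : ∀ s, k < s → s ≤ t → ¬ stops π s
        · rw [if_pos h1, if_neg]
          intro h2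
          have h3 := hmin (t + 1) (by
            rw [Finset.mem_filter, Finset.mem_Ioc]; exact ⟨⟨by omega, by omega⟩, h2⟩)
          exact h1 (T + 1) hT1 (by omega) hT3
        · rw [if_neg h1]
      · intro h
        exact absurd (Finset.mem_Ico.2 ⟨by omega, by omega⟩) h
    · have hT := hstopT π
      rw [dif_neg hne] at hT
      rw [if_neg (by omega)]
      refine (Finset.sum_eq_zero fun t ht => ?_).le
      have ht' := Finset.mem_Ico.1 ht
      have : ¬ stops π (t + 1) := fun h => hne ⟨t + 1, by
        rw [Finset.mem_filter, Finset.mem_Ioc]; exact ⟨⟨by omega, by omega⟩, h⟩⟩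
      simp [this]
  -- evaluate each term
  have hterm : ∀ t ∈ Finset.Ico k n, ∑ π, (if ∀ s, k < s → s ≤ t → ¬ stops π s then
      (if stops π (t + 1) then f (t + 1) π else 0) else 0)
        = k * (condSum a u (t + 1) / t) := by
    intro t ht
    have ht' := Finset.mem_Ico.1 ht
    have htn := ht'.2
    have ht0 : (t : ℝ) ≠ 0 := by
      have : 0 < t := by omega
      positivity
    have h1 := nostop_sum hk1 best hbest1 stops hs t ht'.1 htn.le _
      (step_inv htn (f (t + 1)) best (hfinv (t + 1)))
    have h2 := best_sum htn (f (t + 1)) best hbest1 (hfinv (t + 1))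
    have h3 := sym_sum (n := n) (t := t + 1) htn (fun π => u (pre π (t + 1))) (fun _ => a)
      (fun i j hi hj π => congrArg u (pre_inv (t + 1) i j hi hj π))
      (fun _ _ _ _ _ => rfl) 0 (by simp)
    have h4 : ((t : ℝ) + 1) * condSum a u (t + 1) = ∑ π, f (t + 1) π := by
      have := h3
      push_cast at this
      exact this
    have h5 : ∑ π : Equiv.Perm (Fin n),
        (if π ⟨t, htn⟩ = best (pre π (t + 1)) then f (t + 1) π else 0) = condSum a u (t + 1) := by
      have : (t : ℝ) + 1 ≠ 0 := by positivity
      exact mul_left_cancel₀ this (h2.trans h4.symm)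
    rw [h5] at h1
    simp only [hs _ t htn]
    field_simp
    linarith
  have hsum : (k : ℝ) * ∑ t ∈ Finset.Ico k n, condSum a u (t + 1) / t ≤ ∑ π, payoff π := by
    rw [Finset.mul_sum, ← Finset.sum_congr rfl hterm, Finset.sum_comm]
    exact Finset.sum_le_sum fun π _ => hpay π
  -- numerical part
  let C : ℝ := ∑ π : Equiv.Perm (Fin n), (if π 0 = a then (vbar a sbar : ℝ) else 0)
  have hC : (n : ℝ) * C = n.factorial * vbar a sbar := card_cond a _
  have hC0 : 0 ≤ C := by
    refine Finset.sum_nonneg fun π _ => ?_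
    split_ifs
    · exact NNReal.coe_nonneg _
    · exact le_rfl
  have hH := num_sum (n := n) (k := k) (fun t => condSum a u (t + 1) - C / 2)
    (fun s t hst => sub_le_sub_right (condSum_mono a u humono (by omega)) _)
    (fun t ht => by
      have := condSum_sym a u (vbar a sbar) husub t ht
      have h2 : C ≤ condSum a u (t + 1) + condSum a u (n - 1 - t + 1) := this
      linarith) hk1 hk2 hk3
  have hharm := harm_sum hk1 (by omega) hke
  have hsplit : ∑ t ∈ Finset.Ico k n, (condSum a u (t + 1) - C / 2) / t
      = ∑ t ∈ Finset.Ico k n, condSum a u (t + 1) / t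
        - C / 2 * ∑ t ∈ Finset.Ico k n, 1 / (t : ℝ) := by
    rw [Finset.mul_sum, ← Finset.sum_sub_distrib]
    refine Finset.sum_congr rfl fun t _ => ?_
    ring
  rw [hsplit] at hH
  have hlow : C / 2 ≤ ∑ t ∈ Finset.Ico k n, condSum a u (t + 1) / t := by
    have := mul_le_mul_of_nonneg_left hharm (show 0 ≤ C / 2 by linarith)
    linarith
  have hfin : (k : ℝ) * (C / 2) ≤ ∑ π, payoff π :=
    (mul_le_mul_of_nonneg_left hlow (by positivity)).trans hsum
  have hnR : (0 : ℝ) < n := by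
    have : 0 < n := by omega
    exact_mod_cast this
  have hfac : (0 : ℝ) < n.factorial := by exact_mod_cast n.factorial_pos
  rw [le_div_iff₀ hfac]
  refine le_trans ?_ hfin
  have hcoef : (1 / (2 * Real.exp 1) - ε) * n ≤ k / 2 := by
    have h1 : 1 ≤ ε * n := by
      rw [div_le_iff₀ hε] at hn2
      linarith
    have h2 : (1 / (2 * Real.exp 1)) * n = (n / Real.exp 1) / 2 := by
      field_simp
    rw [sub_mul, h2]
    linarith
  calc (1 / (2 * Real.exp 1) - ε) * (vbar a sbar : ℝ) * n.factorial
      = (1 / (2 * Real.exp 1) - ε) * n * C := by rw [mul_assoc, mul_assoc, hC]; ring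
    _ ≤ k / 2 * C := mul_le_mul_of_nonneg_right hcoef hC0
    _ = k * (C / 2) := by ring
end
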